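/- arXiv:2205.04184 — 2 statements merged into one kernel-verified Lean document; each statement's English description precedes it below -/
import Mathlib

section
/- Let n = 2 and s ≥ 5, so the points lie on a smooth conic in ℙ². Assume m_i ≥ 0 for all i, d ≥ m_i + m_j for all 1 ≤ i < j ≤ s, and 2d ≥ m_1 + ⋯ + m_s (i.e. the divisor D = dH − Σ m_iE_i on the blow-up of ℙ² at the s points is nef). Then dim L_{2,d}(m_1,…,m_s) = C(d+2,2) − Σ_{i=1}^s C(m_i+1,2); equivalently, nef divisors on the blow-up of ℙ² at s points on a conic have vanishing first cohomology. -/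
open Finset

noncomputable section

/-- Binomial coefficient `C(a,k)` with integer arguments; zero if `k < 0` or `a < k`. -/
def Cb (a k : ℤ) : ℤ := if 0 ≤ k ∧ k ≤ a then (Nat.choose a.toNat k.toNat : ℤ) else 0

/-- Iterated partial derivative along a list of coordinate directions, as a linear map. -/
def derivAlong {n : ℕ} (D : List (Fin (n+1))) :
    MvPolynomial (Fin (n+1)) ℂ →ₗ[ℂ] MvPolynomial (Fin (n+1)) ℂ :=
  D.foldr (fun j f => (MvPolynomial.pderiv j).toLinearMap.comp f) LinearMap.id

/-- The point `(1, u, u², …, uⁿ) ∈ ℂ^{n+1}` on the affine cone over the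
rational normal curve of degree `n`. -/
def rncPoint (n : ℕ) (u : ℂ) : Fin (n+1) → ℂ := fun j => u ^ (j : ℕ)

/-- The linear system `L_{n,d}(m_1,…,m_s)`: homogeneous polynomials of degree `d`
in `x_0,…,x_n` all of whose partial derivatives of total order `≤ m_i − 1`
vanish at the point `p_i = (1, t_i, …, t_iⁿ)`. -/
def linSys (n d s : ℕ) (m : Fin s → ℕ) (tp : Fin s → ℂ) :
    Submodule ℂ (MvPolynomial (Fin (n+1)) ℂ) :=
  MvPolynomial.homogeneousSubmodule (Fin (n+1)) ℂ d ⊓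
    ⨅ (i : Fin s), ⨅ (D : List (Fin (n+1))), ⨅ (_ : D.length < m i),
      LinearMap.ker
        ((MvPolynomial.aeval (rncPoint n (tp i))).toLinearMap.comp (derivAlong D))

/-- `k_C = ⌈(m_1+⋯+m_s − nd)/(s−n−2)⌉`. -/
def kC (n d s : ℕ) (m : Fin s → ℕ) : ℤ :=
  ⌈((∑ i, (m i : ℚ)) - (n : ℚ) * d) / ((s : ℚ) - n - 2)⌉


namespace Conic

open MvPolynomial

/-- The polynomial ring in three variables. -/
abbrev R3 := MvPolynomial (Fin 3) ℂ

/-- Vanishing to order at least `m` at `p`, defined recursively through partial derivatives. -/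
def Van (p : Fin 3 → ℂ) : ℕ → R3 → Prop
  | 0, _ => True
  | m + 1, P => aeval p P = 0 ∧ ∀ j, Van p m (pderiv j P)

lemma derivAlong_append (D : List (Fin 3)) (j : Fin 3) (P : R3) :
    derivAlong (n := 2) (D ++ [j]) P = derivAlong (n := 2) D (pderiv j P) := by
  induction D with
  | nil => simp [derivAlong]
  | cons a D ih =>
    simp only [derivAlong, List.cons_append, List.foldr_cons, LinearMap.comp_apply] at ih ⊢
    rw [ih]

lemma van_iff (p : Fin 3 → ℂ) (m : ℕ) (P : R3) :
    Van p m P ↔ ∀ D : List (Fin 3), D.length < m → aeval p (derivAlong (n := 2) D P) = 0 := by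
  induction m generalizing P with
  | zero => simp [Van]
  | succ m ih =>
    simp only [Van, ih]
    constructor
    · rintro ⟨h0, h⟩ D hD
      rcases List.eq_nil_or_concat D with rfl | ⟨D', j, rfl⟩
      · simpa [derivAlong] using h0
      · rw [List.concat_eq_append, derivAlong_append]
        apply h
        simpa using hD
    · intro h
      refine ⟨by simpa [derivAlong] using h [] (by simp), fun j D hD => ?_⟩
      rw [← derivAlong_append]
      apply h
      simpa using hD

/-- The planar linear system. -/
def L3 (d s : ℕ) (m : Fin s → ℕ) (tp : Fin s → ℂ) : Submodule ℂ R3 := linSys 2 d s m tp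

lemma mem_L3 (d s : ℕ) (m : Fin s → ℕ) (tp : Fin s → ℂ) (P : R3) :
    P ∈ L3 d s m tp ↔ P.IsHomogeneous d ∧ ∀ i, Van (rncPoint 2 (tp i)) (m i) P := by
  simp only [van_iff, L3, linSys, Submodule.mem_inf, mem_homogeneousSubmodule, Submodule.mem_iInf,
    LinearMap.mem_ker, LinearMap.comp_apply]
  rfl

lemma van_mono {p : Fin 3 → ℂ} {m k : ℕ} {P : R3} (h : Van p m P) (hk : k ≤ m) : Van p k P := by
  rw [van_iff] at *
  exact fun D hD => h D (by omega)

/-- Multiplicity larger than the degree forces the polynomial to be zero. -/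
lemma eq_zero_of_van {p : Fin 3 → ℂ} (d : ℕ) (P : R3) (hP : P.IsHomogeneous d)
    (h : Van p (d + 1) P) : P = 0 := by
  induction d generalizing P with
  | zero =>
    rw [← totalDegree_zero_iff_isHomogeneous, totalDegree_eq_zero_iff_eq_C] at hP
    have h1 := h.1
    rw [hP] at h1 ⊢
    simp at h1
    simp [h1]
  | succ d ih =>
    have h2 : ∀ j, pderiv j P = 0 := fun j => ih _ (by simpa using hP.pderiv (i := j)) (h.2 j)
    have := hP.sum_X_mul_pderiv
    simp only [h2, mul_zero, Finset.sum_const_zero] at this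
    have h3 : ((d + 1 : ℕ) : R3) * P = 0 := by rw [← nsmul_eq_mul, ← this]
    rcases mul_eq_zero.1 h3 with h4 | h4
    · exact absurd h4 (by exact_mod_cast Nat.succ_ne_zero d)
    · exact h4

lemma pderiv_comm_aux (i j : Fin 3) (P : R3) : pderiv i (pderiv j P) = pderiv j (pderiv i P) := by
  ext s
  simp only [coeff_pderiv]
  by_cases h : i = j
  · subst h; rfl
  · rw [add_right_comm]
    simp [h, Ne.symm h]
    ring

/-- Iterated partial derivative. -/
def itd (k : Fin 3) : ℕ → R3 → R3
  | 0, P => P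
  | a + 1, P => pderiv k (itd k a P)

lemma itd_pderiv (k j : Fin 3) (a : ℕ) (P : R3) :
    itd k a (pderiv j P) = pderiv j (itd k a P) := by
  induction a with
  | zero => rfl
  | succ a ih => rw [itd, itd, ih, pderiv_comm_aux]

/-- Mixed affine derivative. -/
def dd (a b : ℕ) (P : R3) : R3 := itd 1 a (itd 2 b P)

lemma dd_pderiv (a b : ℕ) (j : Fin 3) (P : R3) : dd a b (pderiv j P) = pderiv j (dd a b P) := by
  rw [dd, dd, itd_pderiv, itd_pderiv]

lemma dd_pderiv_one (a b : ℕ) (P : R3) : pderiv 1 (dd a b P) = dd (a + 1) b P := by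
  rw [dd, dd, itd]

lemma dd_pderiv_two (a b : ℕ) (P : R3) : pderiv 2 (dd a b P) = dd a (b + 1) P := by
  rw [dd, dd, itd, itd_pderiv]

lemma dd_hom (a b d : ℕ) (P : R3) (hP : P.IsHomogeneous d) : ∃ e, (dd a b P).IsHomogeneous e := by
  induction a with
  | zero =>
    induction b with
    | zero => exact ⟨d, by simpa [dd, itd] using hP⟩
    | succ b ih => obtain ⟨e, he⟩ := ih; rw [← dd_pderiv_two]; exact ⟨_, he.pderiv⟩
  | succ a ih => obtain ⟨e, he⟩ := ih; rw [← dd_pderiv_one]; exact ⟨_, he.pderiv⟩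

lemma van_of_dd (t : ℂ) (m d : ℕ) (P : R3) (hP : P.IsHomogeneous d)
    (h : ∀ a b, a + b < m → aeval (rncPoint 2 t) (dd a b P) = 0) : Van (rncPoint 2 t) m P := by
  induction m generalizing P d with
  | zero => trivial
  | succ m ih =>
    refine ⟨h 0 0 (by omega), fun j => ?_⟩
    refine ih (d - 1) _ hP.pderiv fun a b hab => ?_
    rw [dd_pderiv]
    have h1 : aeval (rncPoint 2 t) (pderiv 1 (dd a b P)) = 0 := by
      rw [dd_pderiv_one]; exact h _ _ (by omega)
    have h2 : aeval (rncPoint 2 t) (pderiv 2 (dd a b P)) = 0 := by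
      rw [dd_pderiv_two]; exact h _ _ (by omega)
    obtain ⟨e, he⟩ := dd_hom a b d P hP
    have h3 := congrArg (aeval (rncPoint 2 t)) he.sum_X_mul_pderiv
    rw [Fin.sum_univ_three] at h3
    simp only [map_add, map_mul, h1, h2, map_nsmul, h a b (by omega), aeval_X] at h3
    have h0 : aeval (rncPoint 2 t) (pderiv 0 (dd a b P)) = 0 := by
      simpa [rncPoint] using h3
    fin_cases j
    · exact h0
    · exact h1
    · exact h2

/-- Translation. -/
def tr (p : Fin 3 → ℂ) : R3 →ₐ[ℂ] R3 := aeval (fun j => X j + C (p j))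

lemma tr_pderiv (p : Fin 3 → ℂ) (j : Fin 3) (P : R3) : tr p (pderiv j P) = pderiv j (tr p P) := by
  induction P using MvPolynomial.induction_on with
  | C a => simp [tr]
  | add P Q hP hQ => simp [hP, hQ]
  | mul_X P i hP =>
    rw [pderiv_mul, map_add, map_mul, map_mul, map_mul, pderiv_mul, hP]
    congr 2
    by_cases hij : i = j
    · subst hij; simp [tr]
    · simp [tr, pderiv_X, hij]

lemma tr_const (p : Fin 3 → ℂ) (P : R3) : coeff 0 (tr p P) = aeval p P := by
  induction P using MvPolynomial.induction_on with
  | C a => simp [tr]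
  | add P Q hP hQ => simp [hP, hQ]
  | mul_X P i hP =>
    rw [← constantCoeff_eq] at *
    simp [hP]; left; simp [tr]

lemma van_iff_coeff (p : Fin 3 → ℂ) (m : ℕ) (P : R3) :
    Van p m P ↔ ∀ s : Fin 3 →₀ ℕ, s.degree < m → coeff s (tr p P) = 0 := by
  induction m generalizing P with
  | zero => simp [Van]
  | succ m ih =>
    simp only [Van, ih, tr_pderiv, coeff_pderiv]
    constructor
    · rintro ⟨h0, h⟩ s hs
      by_cases hs0 : s = 0
      · subst hs0; rw [tr_const, h0]
      · obtain ⟨j, hj⟩ := Finsupp.ne_iff.1 hs0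
        have hle : Finsupp.single j 1 ≤ s := by
          simp at hj; simp; omega
        have h1 := h j (s - Finsupp.single j 1)
        rw [tsub_add_cancel_of_le hle] at h1
        have h2 : (s - Finsupp.single j 1).degree < m := by
          have := congrArg Finsupp.degree (tsub_add_cancel_of_le hle)
          simp at this
          omega
        rcases mul_eq_zero.1 (h1 h2) with h3 | h3
        · exact h3
        · exact absurd h3 (Nat.cast_add_one_ne_zero _)
    · intro h
      refine ⟨by rw [← tr_const]; exact h 0 (by simp), fun j s hs => ?_⟩
      rw [h _ (by simpa using hs), zero_mul]

/-- The conic. -/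
def q : R3 := X 0 * X 2 - X 1 ^ 2

lemma q_hom : q.IsHomogeneous 2 := by
  unfold q
  exact ((isHomogeneous_X _ _).mul (isHomogeneous_X _ _)).sub ((isHomogeneous_X _ _).pow 2)

/-- Residuation with respect to the conic. -/
lemma van_of_q_mul (t : ℂ) (m : ℕ) (P : R3) (h : Van (rncPoint 2 t) (m + 1) (q * P)) :
    Van (rncPoint 2 t) m P := by
  induction m with
  | zero => trivial
  | succ m ih =>
    set p := rncPoint 2 t with hp
    have h1 := ih (van_mono h (by omega))
    rw [van_iff_coeff] at h h1 ⊢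
    have hPo : (m : ℕ∞) ≤ (tr p P : MvPowerSeries (Fin 3) ℂ).order :=
      MvPowerSeries.nat_le_order (fun s hs => by simpa using h1 s hs)
    have hq1 : Van p 1 q := by
      refine ⟨?_, fun _ => trivial⟩
      simp [q, hp, rncPoint]; 
    have hq2 : coeff (Finsupp.single 2 1) (tr p q) = 1 := by
      have := coeff_pderiv (i := 2) (tr p q) 0
      rw [← tr_pderiv, tr_const] at this
      have h5 : aeval p (pderiv 2 q) = 1 := by
        simp [q, hp, rncPoint, pderiv_X]
      rw [h5] at this
      simpa using this.symm
    rw [van_iff_coeff] at hq1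
    have hqo : ((1 : ℕ) : ℕ∞) ≤ (tr p q : MvPowerSeries (Fin 3) ℂ).order :=
      MvPowerSeries.nat_le_order (fun s hs => by simpa using hq1 s hs)
    have key := MvPowerSeries.homogeneousComponent_mul_of_le_order hqo hPo
    have hz : MvPowerSeries.homogeneousComponent (1 + m)
        ((tr p q : MvPowerSeries (Fin 3) ℂ) * (tr p P : MvPowerSeries (Fin 3) ℂ)) = 0 := by
      ext s
      rw [MvPowerSeries.coeff_homogeneousComponent]
      split_ifs with hs
      · rw [← MvPolynomial.coe_mul, ← map_mul, coeff_coe, h s (by omega)]; simp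
      · simp
    rw [hz] at key
    rcases mul_eq_zero.1 key.symm with h3 | h3
    · have := congrArg (MvPowerSeries.coeff (Finsupp.single 2 1)) h3
      rw [MvPowerSeries.coeff_homogeneousComponent] at this
      simp [hq2] at this
    · intro s hs
      rcases Nat.lt_succ_iff_lt_or_eq.1 hs with h4 | h4
      · exact h1 s h4
      · have := congrArg (MvPowerSeries.coeff s) h3
        rw [MvPowerSeries.coeff_homogeneousComponent] at this
        simpa [h4] using this

end Conic

namespace Conic

open MvPolynomial

lemma choose_two_succ (k : ℕ) : (k + 1).choose 2 = k + k.choose 2 := by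
  rw [Nat.choose_succ_succ' k 1, Nat.choose_one_right]

/-- Restriction to the conic. -/
def r : R3 →ₐ[ℂ] Polynomial ℂ := aeval (fun j : Fin 3 => (Polynomial.X : Polynomial ℂ) ^ (j : ℕ))

lemma r_eval (t : ℂ) (P : R3) : (r P).eval t = aeval (rncPoint 2 t) P := by
  induction P using MvPolynomial.induction_on with
  | C a => simp [r]
  | add P Q hP hQ => simp [hP, hQ]
  | mul_X P i hP => simp only [map_mul, Polynomial.eval_mul, hP]; simp [r, rncPoint]

lemma r_deriv (P : R3) : Polynomial.derivative (r P) =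
    r (pderiv 1 P) + 2 * Polynomial.X * r (pderiv 2 P) := by
  induction P using MvPolynomial.induction_on with
  | C a => simp [r]
  | add P Q hP hQ => simp [hP, hQ]; ring
  | mul_X P i hP =>
    rw [map_mul, Polynomial.derivative_mul, hP, pderiv_mul, pderiv_mul]
    simp only [map_add, map_mul]
    fin_cases i <;> simp [r, pderiv_X] <;> ring

lemma r_van (t : ℂ) (m : ℕ) (P : R3) (h : Van (rncPoint 2 t) m P) :
    (Polynomial.X - Polynomial.C t) ^ m ∣ r P := by
  induction m generalizing P with
  | zero => simp
  | succ m ih =>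
    have h0 : (r P).IsRoot t := by rw [Polynomial.IsRoot, r_eval]; exact h.1
    by_cases hr : r P = 0
    · rw [hr]; exact dvd_zero _
    have hd : (Polynomial.X - Polynomial.C t) ^ m ∣ Polynomial.derivative (r P) := by
      rw [r_deriv]
      exact dvd_add (ih _ (h.2 1)) (Dvd.dvd.mul_left (ih _ (h.2 2)) _)
    have hd0 : Polynomial.derivative (r P) ≠ 0 := by
      intro hc
      have := Polynomial.derivative_eq_zero.1 hc
      rw [Polynomial.eq_C_of_natDegree_eq_zero this] at h0 hr
      simp at h0
      simp [h0] at hr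
    rw [← Polynomial.le_rootMultiplicity_iff hr]
    rw [← Polynomial.le_rootMultiplicity_iff hd0,
      Polynomial.derivative_rootMultiplicity_of_root h0] at hd
    have := (Polynomial.rootMultiplicity_pos hr).2 h0
    omega

lemma r_monomial (s : Fin 3 →₀ ℕ) (a : ℂ) :
    r (monomial s a) = Polynomial.C a * Polynomial.X ^ (s 1 + 2 * s 2) := by
  rw [r, aeval_monomial, Finsupp.prod_fintype _ _ (by simp), Fin.prod_univ_three]
  simp [← pow_mul, ← pow_add]

lemma r_deg (d : ℕ) (P : R3) (hP : P.IsHomogeneous d) :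
    r P ∈ Polynomial.degreeLT ℂ (2 * d + 1) := by
  rw [P.as_sum, map_sum]
  refine Submodule.sum_mem _ fun s hs => ?_
  rw [r_monomial, Polynomial.mem_degreeLT]
  have h1 : s.degree = d := by
    by_contra hne
    exact (mem_support_iff.1 hs) (hP.coeff_eq_zero hne)
  rw [Finsupp.degree_eq_sum, Fin.sum_univ_three] at h1
  refine lt_of_le_of_lt (Polynomial.degree_C_mul_X_pow_le _ _) ?_
  norm_cast
  omega

lemma finrank_H (d : ℕ) :
    Module.finrank ℂ (homogeneousSubmodule (Fin 3) ℂ d) = (d + 2).choose 2 := by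
  have h : ((Finset.univ : Finset (Fin 3)).finsuppAntidiag d : Set (Fin 3 →₀ ℕ))
      = {s | s.degree = d} := by
    ext s
    simp [Finset.mem_finsuppAntidiag, Finsupp.degree_eq_sum]
  rw [homogeneousSubmodule_eq_finsupp_supported, ← h]
  have e : Module.finrank ℂ (AddMonoidAlgebra.supported ℂ ℂ
      (((Finset.univ : Finset (Fin 3)).finsuppAntidiag d : Set (Fin 3 →₀ ℕ)))) =
      ((Finset.univ : Finset (Fin 3)).finsuppAntidiag d).card := by
    rw [LinearEquiv.finrank_eq (AddMonoidAlgebra.supportedEquivFinsupp _)]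
    rw [Module.finrank_finsupp]
    simp
  rw [e, Finset.card_finsuppAntidiag_nat_eq_choose]
  simp only [Finset.card_univ, Fintype.card_fin]
  rw [show 3 + d - 1 = d + 2 by omega, ← Nat.choose_symm_add]

instance finH (d : ℕ) : Module.Finite ℂ (homogeneousSubmodule (Fin 3) ℂ d) :=
  Module.Finite.iff_fg.2 (homogeneousSubmodule_fg _ _ d)

lemma rank_split {V W : Type*} [AddCommGroup V] [Module ℂ V] [AddCommGroup W] [Module ℂ W]
    (H : Submodule ℂ V) [Module.Finite ℂ H] (f : V →ₗ[ℂ] W) :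
    Module.finrank ℂ (H.map f) + Module.finrank ℂ (H ⊓ LinearMap.ker f : Submodule ℂ V) =
      Module.finrank ℂ H := by
  rw [← LinearMap.finrank_range_add_finrank_ker (f.domRestrict H), LinearMap.range_domRestrict]
  congr 1
  rw [← Submodule.finrank_map_subtype_eq H]
  have : H ⊓ LinearMap.ker f = Submodule.map H.subtype (LinearMap.ker (f.domRestrict H)) := by
    ext x
    simp [and_comm]
  rw [this]

lemma map_r_H (d : ℕ) : (homogeneousSubmodule (Fin 3) ℂ d).map r.toLinearMap =
    Polynomial.degreeLT ℂ (2 * d + 1) := by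
  apply le_antisymm
  · rintro _ ⟨P, hP, rfl⟩
    exact r_deg d P hP
  · rw [Polynomial.degreeLT_eq_span_X_pow, Submodule.span_le]
    intro f hf
    simp only [Finset.coe_image, Set.mem_image, Finset.mem_coe, Finset.mem_range] at hf
    obtain ⟨k, hk, rfl⟩ := hf
    refine ⟨X 0 ^ (d - k % 2 - k / 2) * X 1 ^ (k % 2) * X 2 ^ (k / 2), ?_, ?_⟩
    · have := (((isHomogeneous_X ℂ (0 : Fin 3)).pow (d - k % 2 - k / 2)).mul
        ((isHomogeneous_X ℂ (1 : Fin 3)).pow (k % 2))).mul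
        ((isHomogeneous_X ℂ (2 : Fin 3)).pow (k / 2))
      have e : 1 * (d - k % 2 - k / 2) + 1 * (k % 2) + 1 * (k / 2) = d := by omega
      rwa [e] at this
    · simp only [AlgHom.toLinearMap_apply, map_mul, map_pow]
      simp only [r, aeval_X]
      simp only [Fin.val_zero, Fin.val_one, Fin.val_two, pow_zero, one_pow, one_mul, pow_one,
        ← pow_mul, ← pow_add]
      congr 1
      omega

lemma finrank_degreeLT (n : ℕ) : Module.finrank ℂ (Polynomial.degreeLT ℂ n) = n := by
  rw [LinearEquiv.finrank_eq (Polynomial.degreeLTEquiv ℂ n)]; simp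

instance finDeg (n : ℕ) : Module.Finite ℂ (Polynomial.degreeLT ℂ n) :=
  Module.Finite.equiv (Polynomial.degreeLTEquiv ℂ n).symm

lemma finrank_ker (d : ℕ) : Module.finrank ℂ
    (homogeneousSubmodule (Fin 3) ℂ d ⊓ LinearMap.ker r.toLinearMap : Submodule ℂ R3) =
      d.choose 2 := by
  have h := rank_split (homogeneousSubmodule (Fin 3) ℂ d) r.toLinearMap
  rw [map_r_H, finrank_degreeLT, finrank_H] at h
  have h1 : (d + 2).choose 2 = _ := choose_two_succ (d + 1)
  have h2 := choose_two_succ d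
  have h3 : (2 * d + 1) + Module.finrank ℂ (homogeneousSubmodule (Fin 3) ℂ d ⊓
    LinearMap.ker r.toLinearMap : Submodule ℂ R3) = (d + 2).choose 2 := h
  have h4 : (2 * d + 1) + d.choose 2 = (d + 2).choose 2 := by omega
  exact Nat.add_left_cancel (h3.trans h4.symm)

lemma q_ne : q ≠ 0 := by
  intro h
  have := congrArg (aeval (fun j : Fin 3 => if j = 1 then (1 : ℂ) else 0)) h
  simp [q] at this

lemma r_q : r q = 0 := by
  simp [q, r]

lemma ker_low (d : ℕ) (hd : d < 2) :
    (homogeneousSubmodule (Fin 3) ℂ d ⊓ LinearMap.ker r.toLinearMap : Submodule ℂ R3) = ⊥ := by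
  have h := finrank_ker d
  rw [Nat.choose_eq_zero_of_lt hd] at h
  have := Submodule.finiteDimensional_inf_left (homogeneousSubmodule (Fin 3) ℂ d)
    (LinearMap.ker r.toLinearMap)
  exact Submodule.finrank_eq_zero.1 h

lemma mulq_inj : Function.Injective (LinearMap.mulLeft ℂ q) := fun _ _ h =>
  mul_left_cancel₀ q_ne h

lemma ker_high (d : ℕ) :
    (homogeneousSubmodule (Fin 3) ℂ (d + 2) ⊓ LinearMap.ker r.toLinearMap : Submodule ℂ R3) =
      (homogeneousSubmodule (Fin 3) ℂ d).map (LinearMap.mulLeft ℂ q) := by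
  symm
  have := Submodule.finiteDimensional_inf_left (homogeneousSubmodule (Fin 3) ℂ (d + 2))
    (LinearMap.ker r.toLinearMap)
  apply Submodule.eq_of_le_of_finrank_eq
  · rintro _ ⟨P, hP, rfl⟩
    refine ⟨?_, ?_⟩
    · have := q_hom.mul hP
      rw [add_comm] at this
      exact this
    · simp [r_q]
  · rw [finrank_ker, ← (Submodule.equivMapOfInjective _ mulq_inj _).finrank_eq, finrank_H]

end Conic

namespace Conic

open MvPolynomial

lemma L3_le (d s : ℕ) (m : Fin s → ℕ) (tp : Fin s → ℂ) :
    L3 d s m tp ≤ homogeneousSubmodule (Fin 3) ℂ d := inf_le_left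

instance finL (d s : ℕ) (m : Fin s → ℕ) (tp : Fin s → ℂ) :
    Module.Finite ℂ (L3 d s m tp) :=
  Submodule.finiteDimensional_of_le (L3_le d s m tp)

/-- Linear version of `itd`. -/
def itdL (k : Fin 3) : ℕ → R3 →ₗ[ℂ] R3
  | 0 => LinearMap.id
  | a + 1 => (pderiv k).toLinearMap ∘ₗ itdL k a

lemma itdL_apply (k : Fin 3) (a : ℕ) (P : R3) : itdL k a P = itd k a P := by
  induction a with
  | zero => rfl
  | succ a ih => rw [itd, ← ih]; rfl

/-- The index set of the conditions. -/
abbrev Idx (s : ℕ) (m : Fin s → ℕ) := Σ i : Fin s, Σ k : Fin (m i), Fin ((k : ℕ) + 1)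

lemma sum_tri (m : ℕ) : ∑ k : Fin m, ((k : ℕ) + 1) = (m + 1).choose 2 := by
  rw [Fin.sum_univ_eq_sum_range (fun k => k + 1) m]
  induction m with
  | zero => rfl
  | succ m ih => rw [Finset.sum_range_succ, ih, choose_two_succ (m + 1)]; omega

lemma card_idx (s : ℕ) (m : Fin s → ℕ) :
    Fintype.card (Idx s m) = ∑ i, (m i + 1).choose 2 := by
  simp only [Idx, Fintype.card_sigma, Fintype.card_fin, sum_tri]

/-- The evaluation map collecting all conditions. -/
def ev (s : ℕ) (m : Fin s → ℕ) (tp : Fin s → ℂ) : R3 →ₗ[ℂ] (Idx s m → ℂ) :=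
  LinearMap.pi fun x => (aeval (rncPoint 2 (tp x.1))).toLinearMap ∘ₗ
    itdL 1 (x.2.2 : ℕ) ∘ₗ itdL 2 ((x.2.1 : ℕ) - (x.2.2 : ℕ))

lemma lower (d s : ℕ) (m : Fin s → ℕ) (tp : Fin s → ℂ) :
    (d + 2).choose 2 ≤ Module.finrank ℂ (L3 d s m tp) + ∑ i, (m i + 1).choose 2 := by
  have h := rank_split (homogeneousSubmodule (Fin 3) ℂ d) (ev s m tp)
  rw [finrank_H] at h
  have h1 : Module.finrank ℂ ((homogeneousSubmodule (Fin 3) ℂ d).map (ev s m tp)) ≤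
      ∑ i, (m i + 1).choose 2 := by
    refine (Submodule.finrank_le _).trans ?_
    rw [Module.finrank_fintype_fun_eq_card, card_idx]
  have h2 : homogeneousSubmodule (Fin 3) ℂ d ⊓ LinearMap.ker (ev s m tp) ≤ L3 d s m tp := by
    rintro P ⟨hP, hk⟩
    rw [mem_L3]
    refine ⟨hP, fun i => van_of_dd _ _ d P hP fun a b hab => ?_⟩
    have := congrFun (LinearMap.mem_ker.1 hk) ⟨i, ⟨a + b, hab⟩, ⟨a, by simp⟩⟩
    simpa [ev, itdL_apply, dd] using this
  have h3 : _ ≤ Module.finrank ℂ (L3 d s m tp) := Submodule.finrank_mono h2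
  calc (d + 2).choose 2 = _ := h.symm
    _ ≤ (∑ i, (m i + 1).choose 2) + Module.finrank ℂ (L3 d s m tp) := add_le_add h1 h3
    _ = _ := add_comm _ _

lemma step (d s : ℕ) (m : Fin s → ℕ) (tp : Fin s → ℂ) (htp : Function.Injective tp)
    (hm : ∑ i, m i ≤ 2 * d) :
    Module.finrank ℂ (L3 d s m tp) + ∑ i, m i ≤ Module.finrank ℂ
      (L3 d s m tp ⊓ LinearMap.ker r.toLinearMap : Submodule ℂ R3) + (2 * d + 1) := by
  have h := rank_split (L3 d s m tp) r.toLinearMap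
  let g : Polynomial ℂ := ∏ i, (Polynomial.X - Polynomial.C (tp i)) ^ m i
  have hg : g.Monic := Polynomial.monic_prod_of_monic _ _
    fun i _ => (Polynomial.monic_X_sub_C _).pow _
  have hgd : g.natDegree = ∑ i, m i := by
    rw [Polynomial.natDegree_prod_of_monic _ _ fun i _ => (Polynomial.monic_X_sub_C _).pow _]
    simp
  have h1 : (L3 d s m tp).map r.toLinearMap ≤
      (Polynomial.degreeLT ℂ (2 * d + 1 - ∑ i, m i)).map (LinearMap.mulLeft ℂ g) := by
    rintro _ ⟨P, hP, rfl⟩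
    rw [SetLike.mem_coe, mem_L3] at hP
    have hdvd : g ∣ r P := by
      apply Finset.prod_dvd_of_coprime
      · intro i _ j _ hij
        exact (Polynomial.isCoprime_X_sub_C_of_isUnit_sub
          (sub_ne_zero.2 (htp.ne hij)).isUnit).pow
      · exact fun i _ => r_van _ _ _ (hP.2 i)
    obtain ⟨f, hf⟩ := hdvd
    refine ⟨f, ?_, hf.symm⟩
    rw [SetLike.mem_coe, Polynomial.mem_degreeLT]
    by_cases hf0 : f = 0
    · rw [hf0, Polynomial.degree_zero]; exact WithBot.bot_lt_coe _
    have h2 := r_deg d P hP.1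
    rw [hf, Polynomial.mem_degreeLT, Polynomial.degree_mul, Polynomial.degree_eq_natDegree hf0,
      Polynomial.degree_eq_natDegree hg.ne_zero, hgd] at h2
    rw [Polynomial.degree_eq_natDegree hf0]
    norm_cast at h2 ⊢
    omega
  have h2 := Submodule.finrank_mono h1
  have h3 := Submodule.finrank_map_le (LinearMap.mulLeft ℂ g)
    (Polynomial.degreeLT ℂ (2 * d + 1 - ∑ i, m i))
  rw [finrank_degreeLT] at h3
  omega

lemma resid (d s : ℕ) (m : Fin s → ℕ) (tp : Fin s → ℂ) :
    Module.finrank ℂ (L3 (d + 2) s m tp ⊓ LinearMap.ker r.toLinearMap : Submodule ℂ R3) ≤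
      Module.finrank ℂ (L3 d s (fun i => m i - 1) tp) := by
  have h1 : L3 (d + 2) s m tp ⊓ LinearMap.ker r.toLinearMap ≤
      (L3 d s (fun i => m i - 1) tp).map (LinearMap.mulLeft ℂ q) := by
    rintro P ⟨hP, hk⟩
    have h2 : P ∈ (homogeneousSubmodule (Fin 3) ℂ (d + 2) ⊓ LinearMap.ker r.toLinearMap :
      Submodule ℂ R3) := ⟨L3_le _ _ _ _ hP, hk⟩
    rw [ker_high] at h2
    obtain ⟨Q, hQ, rfl⟩ := h2
    refine ⟨Q, ?_, rfl⟩
    rw [SetLike.mem_coe, mem_L3] at *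
    refine ⟨hQ, fun i => ?_⟩
    rcases Nat.eq_zero_or_pos (m i) with h0 | h0
    · simp only [h0]; trivial
    · apply van_of_q_mul
      rw [Nat.sub_add_cancel h0]
      exact hP.2 i
  exact (Submodule.finrank_mono h1).trans (Submodule.finrank_map_le _ _)

lemma choose_pred (k : ℕ) : (k + 1).choose 2 = k + (k - 1 + 1).choose 2 := by
  cases k with
  | zero => rfl
  | succ k => rw [choose_two_succ (k + 1)]; rfl

/-- The combinatorial step: the sum condition is inherited. -/
lemma sum_step (d s : ℕ) (m : Fin s → ℕ) (h1 : ∀ i j, i ≠ j → m i + m j ≤ d + 2)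
    (h2 : ∑ i, m i ≤ 2 * (d + 2)) (h3 : ∀ i, m i ≤ d + 1) :
    (∀ i j, i ≠ j → (m i - 1) + (m j - 1) ≤ d) ∧ ∑ i, (m i - 1) ≤ 2 * d := by
  have hp : ∀ i j, i ≠ j → (m i - 1) + (m j - 1) ≤ d := by
    intro i j hij
    have := h1 i j hij
    have := h3 i
    have := h3 j
    omega
  refine ⟨hp, ?_⟩
  let S : Finset (Fin s) := Finset.univ.filter fun i => 0 < m i
  have e1 : ∑ i, m i = ∑ i ∈ S, m i := by
    symm
    apply Finset.sum_subset (Finset.subset_univ _)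
    intro i _ hi
    simp [S] at hi
    omega
  have e2 : ∑ i, (m i - 1) = ∑ i ∈ S, (m i - 1) := by
    symm
    apply Finset.sum_subset (Finset.subset_univ _)
    intro i _ hi
    simp [S] at hi
    omega
  have e3 : ∑ i ∈ S, (m i - 1) + S.card = ∑ i ∈ S, m i := by
    rw [Finset.card_eq_sum_ones, ← Finset.sum_add_distrib]
    apply Finset.sum_congr rfl
    intro i hi
    simp [S] at hi
    omega
  rcases Nat.lt_or_ge S.card 4 with hc | hc
  · rw [e2]
    have : S.card = 0 ∨ S.card = 1 ∨ S.card = 2 ∨ S.card = 3 := by omega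
    rcases this with h | h | h | h
    · rw [Finset.card_eq_zero] at h
      simp [h]
    · rw [Finset.card_eq_one] at h
      obtain ⟨a, ha⟩ := h
      rw [ha, Finset.sum_singleton]
      have := h3 a
      omega
    · rw [Finset.card_eq_two] at h
      obtain ⟨a, b, hab, ha⟩ := h
      rw [ha, Finset.sum_pair hab]
      have := hp a b hab
      omega
    · rw [Finset.card_eq_three] at h
      obtain ⟨a, b, c, hab, hac, hbc, ha⟩ := h
      rw [ha, Finset.sum_insert (by simp [hab, hac]), Finset.sum_pair hbc]
      have := hp a b hab
      have := hp a c hac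
      have := hp b c hbc
      omega
  · omega

lemma upper (s : ℕ) (hs : 2 ≤ s) (tp : Fin s → ℂ) (htp : Function.Injective tp) (d : ℕ)
    (m : Fin s → ℕ) (h1 : ∀ i j, i ≠ j → m i + m j ≤ d) (h2 : ∑ i, m i ≤ 2 * d) :
    Module.finrank ℂ (L3 d s m tp) + ∑ i, (m i + 1).choose 2 ≤ (d + 2).choose 2 := by
  have hmd : ∀ i, m i ≤ d := by
    intro i
    have : Nontrivial (Fin s) := Fin.nontrivial_iff_two_le.2 hs
    obtain ⟨j, hj⟩ := exists_ne i
    have := h1 i j hj.symm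
    omega
  induction d using Nat.strong_induction_on generalizing m with
  | _ d ih =>
  have hst := step d s m tp htp h2
  have e1 : ∑ i, (m i + 1).choose 2 = ∑ i, m i + ∑ i, (m i - 1 + 1).choose 2 := by
    rw [← Finset.sum_add_distrib]
    exact Finset.sum_congr rfl fun i _ => choose_pred (m i)
  have e2 : (d + 2).choose 2 = d.choose 2 + (2 * d + 1) := by
    have h1 : (d + 2).choose 2 = _ := choose_two_succ (d + 1)
    have h2 := choose_two_succ d
    omega
  rw [e1, e2]
  rcases Nat.lt_or_ge d 2 with hd | hd
  · have hk : (L3 d s m tp ⊓ LinearMap.ker r.toLinearMap : Submodule ℂ R3) = ⊥ := by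
      rw [eq_bot_iff, ← ker_low d hd]
      exact inf_le_inf_right _ (L3_le _ _ _ _)
    rw [hk, finrank_bot] at hst
    have : ∑ i, (m i - 1 + 1).choose 2 = 0 := by
      apply Finset.sum_eq_zero
      intro i _
      apply Nat.choose_eq_zero_of_lt
      have := hmd i
      omega
    omega
  · obtain ⟨e, rfl⟩ := Nat.exists_eq_add_of_le' hd
    have hre := resid e s m tp
    suffices hsuf : Module.finrank ℂ (L3 e s (fun i => m i - 1) tp) +
        ∑ i, (m i - 1 + 1).choose 2 ≤ (e + 2).choose 2 by omega
    by_cases hmax : ∃ i, m i = e + 2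
    · obtain ⟨i, hi⟩ := hmax
      have hz : L3 e s (fun i => m i - 1) tp = ⊥ := by
        rw [eq_bot_iff]
        intro P hP
        rw [mem_L3] at hP
        have := hP.2 i
        simp only [hi] at this
        exact eq_zero_of_van e P hP.1 this
      rw [hz, finrank_bot, Finset.sum_eq_single i]
      · simp [hi]
      · intro j _ hj
        have := h1 i j hj.symm
        have h0 : m j = 0 := by omega
        simp [h0]
      · simp
    · push Not at hmax
      obtain ⟨a, b⟩ := sum_step e s m h1 h2 (fun i => by
        have := hmd i
        have := hmax i
        omega)
      exact ih e (by omega) (fun i => m i - 1) a b (fun i => by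
        have := hmd i
        have := hmax i
        omega)

lemma Cb_two (a : ℕ) : Cb (a : ℤ) 2 = (a.choose 2 : ℕ) := by
  unfold Cb
  split_ifs with h
  · simp
  · rw [Nat.choose_eq_zero_of_lt (by omega)]; rfl

end Conic

/-- **Nef divisors on the blow-up of `ℙ²` at points on a conic have no higher
cohomology (Proposition 1.8 / Remark 1.9).** If `d ≥ m_i + m_j` for all `i < j` and
`2d ≥ Σ m_i`, then `dim L_{2,d}(m_1,…,m_s) = C(d+2,2) − Σᵢ C(mᵢ+1,2)`. -/
theorem stmt_8 (d s : ℕ) (hs : 5 ≤ s)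
    (m : Fin s → ℕ) (tp : Fin s → ℂ) (htp : Function.Injective tp)
    (hnef1 : ∀ i j : Fin s, i < j → m i + m j ≤ d)
    (hnef2 : (∑ i, m i) ≤ 2 * d) :
    (Module.finrank ℂ (linSys 2 d s m tp) : ℤ) =
      Cb ((d : ℤ) + 2) 2 - ∑ i, Cb ((m i : ℤ) + 1) 2 := by
  have h1 : ∀ i j, i ≠ j → m i + m j ≤ d := by
    intro i j hij
    rcases lt_or_gt_of_ne hij with h | h
    · exact hnef1 i j h
    · rw [add_comm]; exact hnef1 j i h
  have hu := Conic.upper s (by omega) tp htp d m h1 hnef2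
  have hl := Conic.lower d s m tp
  have e1 : Cb ((d : ℤ) + 2) 2 = ((d + 2).choose 2 : ℕ) := by exact_mod_cast Conic.Cb_two (d + 2)
  have e2 : ∀ i, Cb ((m i : ℤ) + 1) 2 = ((m i + 1).choose 2 : ℕ) := fun i => by
    exact_mod_cast Conic.Cb_two (m i + 1)
  simp only [e1, e2, ← Nat.cast_sum]
  change (Module.finrank ℂ (Conic.L3 d s m tp) : ℤ) = _
  omega

end
end

section
/- Let n = 2 and s ≥ 5, suppose L = L_{2,d}(m_1,…,m_s) ≠ 0, m_i ≥ 0 for all i, and m_i ≥ k_C(d,m) for all i (non-redundant). Set k := max(k_C(d,m), 0), d' := d − 2k, m'_i := m_i − k, and let L' := L_{2,d'}(m'_1,…,m'_s). Then: L' ≠ 0; m'_i ≥ 0 for all i; m'_i + m'_j − d' = m_i + m_j − d for all 1 ≤ i < j ≤ s; k_C(d', m') ≤ 0; and G(d', m') = G(d, m). -/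
open Finset

noncomputable section

/-- The linear system `L_{n,d}(m_1,…,m_s)` with integer degree and multiplicities:
homogeneous polynomials of degree `d` in `x_0,…,x_n` all of whose partial derivatives
of total order `≤ m_i − 1` vanish at `p_i = (1, t_i, …, t_iⁿ)`; it is zero if `d < 0`. -/
def linSysZ (n : ℕ) (d : ℤ) (s : ℕ) (m : Fin s → ℤ) (tp : Fin s → ℂ) :
    Submodule ℂ (MvPolynomial (Fin (n+1)) ℂ) :=
  if 0 ≤ d then
    MvPolynomial.homogeneousSubmodule (Fin (n+1)) ℂ d.toNat ⊓
      ⨅ (i : Fin s), ⨅ (D : List (Fin (n+1))), ⨅ (_ : (D.length : ℤ) < m i),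
        LinearMap.ker
          ((MvPolynomial.aeval (rncPoint n (tp i))).toLinearMap.comp (derivAlong D))
  else ⊥

/-- `k_C(d,m) = ⌈(m_1+⋯+m_s − 2d)/(s−4)⌉` (planar case `n = 2`). -/
def kC2 (d : ℤ) (s : ℕ) (m : Fin s → ℤ) : ℤ :=
  ⌈((∑ i, (m i : ℚ)) - 2 * (d : ℚ)) / ((s : ℚ) - 4)⌉

/-- The exceeding number `ε(d,m)`, i.e. the unique `ε ∈ {0,…,s−5}` with
`k_C = (Σ mᵢ − 2d + ε)/(s−4)` (planar case `n = 2`). -/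
def eps2 (d : ℤ) (s : ℕ) (m : Fin s → ℤ) : ℤ :=
  ((s : ℤ) - 4) * kC2 d s m - ((∑ i, m i) - 2 * d)

/-- The function `G(d,m)` computing the dimension of planar systems with base points on
a conic. -/
def G2 (d : ℤ) (s : ℕ) (m : Fin s → ℤ) : ℤ :=
  Cb (d + 2) 2 - ∑ i, Cb (m i + 1) 2
    + ∑ p ∈ Finset.univ.filter (fun p : Fin s × Fin s => p.1 < p.2),
        Cb (m p.1 + m p.2 - d) 2
    + Cb (kC2 d s m) 2 + ((s : ℤ) - 5) * Cb (kC2 d s m + 1) 2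
    - eps2 d s m * Cb (kC2 d s m) 1

section Helpers

open MvPolynomial

/-- Vanishing to order `m` at the point `p`. -/
def VanAt (m : ℕ) (p : Fin 3 → ℂ) (P : MvPolynomial (Fin 3) ℂ) : Prop :=
  ∀ D : List (Fin 3), D.length < m → aeval p (derivAlong (n := 2) D P) = 0

lemma derivAlong_append (D : List (Fin 3)) (j : Fin 3) (P : MvPolynomial (Fin 3) ℂ) :
    derivAlong (n := 2) (D ++ [j]) P = derivAlong (n := 2) D (pderiv j P) := by
  induction D with
  | nil => simp [derivAlong]
  | cons a D ih =>
    have h1 : derivAlong (n := 2) (a :: D ++ [j]) P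
        = pderiv a (derivAlong (n := 2) (D ++ [j]) P) := rfl
    have h2 : derivAlong (n := 2) (a :: D) (pderiv j P)
        = pderiv a (derivAlong (n := 2) D (pderiv j P)) := rfl
    rw [h1, h2, ih]

lemma vanAt_succ (m : ℕ) (p : Fin 3 → ℂ) (P : MvPolynomial (Fin 3) ℂ) :
    VanAt (m + 1) p P ↔ aeval p P = 0 ∧ ∀ j, VanAt m p (pderiv j P) := by
  constructor
  · intro h
    refine ⟨by simpa [derivAlong] using h [] (by simp), fun j D hD => ?_⟩
    rw [← derivAlong_append]
    exact h _ (by simpa using hD)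
  · rintro ⟨h0, h⟩ D hD
    rcases List.eq_nil_or_concat D with rfl | ⟨D', j, rfl⟩
    · simpa [derivAlong] using h0
    · rw [List.concat_eq_append, derivAlong_append]
      exact h j D' (by simpa using hD)

/-- All coefficients of degree below `m` vanish. -/
def LowZero (m : ℕ) (R : MvPolynomial (Fin 3) ℂ) : Prop :=
  ∀ e : Fin 3 →₀ ℕ, e.degree < m → coeff e R = 0

lemma lowZero_succ (m : ℕ) (R : MvPolynomial (Fin 3) ℂ) :
    LowZero (m + 1) R ↔ coeff 0 R = 0 ∧ ∀ j, LowZero m (pderiv j R) := by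
  constructor
  · intro h
    refine ⟨h 0 (by simp), fun j e he => ?_⟩
    rw [coeff_pderiv, h _ (by simpa using he)]
    simp
  · rintro ⟨h0, h⟩ e he
    by_cases he0 : e = 0
    · rw [he0, h0]
    · obtain ⟨j, hj⟩ : ∃ j, e j ≠ 0 := by
        by_contra! hc
        exact he0 (Finsupp.ext hc)
      have hsplit : e = (e - Finsupp.single j 1) + Finsupp.single j 1 := by
        rw [tsub_add_cancel_of_le]
        simpa [Nat.one_le_iff_ne_zero] using hj
      have hdeg := congrArg Finsupp.degree hsplit
      simp only [map_add, Finsupp.degree_single] at hdeg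
      have := h j (e - Finsupp.single j 1) (by omega)
      rw [coeff_pderiv, ← hsplit] at this
      rcases mul_eq_zero.mp this with h | h
      · exact h
      · exact absurd h (Nat.cast_add_one_ne_zero _)

/-- Translation of the point `p` to the origin. -/
def shiftTo (p : Fin 3 → ℂ) : MvPolynomial (Fin 3) ℂ →ₐ[ℂ] MvPolynomial (Fin 3) ℂ :=
  aeval (fun j => X j + C (p j))

lemma coeff_zero_shiftTo (p : Fin 3 → ℂ) (P : MvPolynomial (Fin 3) ℂ) :
    coeff 0 (shiftTo p P) = aeval p P := by
  have : (aeval (0 : Fin 3 → ℂ)).comp (shiftTo p) = (aeval p : _ →ₐ[ℂ] ℂ) := by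
    ext j; simp [shiftTo]
  rw [← this, AlgHom.comp_apply, ← constantCoeff_eq, aeval_zero]
  simp

lemma pderiv_shiftTo (p : Fin 3 → ℂ) (j : Fin 3) (P : MvPolynomial (Fin 3) ℂ) :
    pderiv j (shiftTo p P) = shiftTo p (pderiv j P) := by
  induction P using MvPolynomial.induction_on with
  | C a => simp [shiftTo]
  | add f g hf hg => simp [hf, hg]
  | mul_X f i hf =>
    have hX : shiftTo p (X i) = X i + C (p i) := by simp [shiftTo]
    simp only [map_mul, pderiv_mul, hf, hX, map_add, pderiv_C, add_zero]
    congr 2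
    by_cases h : i = j
    · subst h; simp
    · simp [pderiv_X_of_ne h]

lemma vanAt_iff (m : ℕ) (p : Fin 3 → ℂ) (P : MvPolynomial (Fin 3) ℂ) :
    VanAt m p P ↔ LowZero m (shiftTo p P) := by
  induction m generalizing P with
  | zero => simp [VanAt, LowZero]
  | succ m ih =>
    rw [vanAt_succ, lowZero_succ, coeff_zero_shiftTo]
    simp only [pderiv_shiftTo, ih]

lemma lowZero_iff (m : ℕ) (R : MvPolynomial (Fin 3) ℂ) :
    LowZero m R ↔ (m : ℕ∞) ≤ (R : MvPowerSeries (Fin 3) ℂ).order := by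
  constructor
  · intro h
    apply MvPowerSeries.nat_le_order
    intro e he
    simpa using h e he
  · intro h e he
    have := MvPowerSeries.coeff_of_lt_order (f := (R : MvPowerSeries (Fin 3) ℂ)) (d := e)
      (lt_of_lt_of_le (by exact_mod_cast he) h)
    simpa using this

lemma vanAt_of_mul (m : ℕ) (p : Fin 3 → ℂ) (F Q : MvPolynomial (Fin 3) ℂ) (j : Fin 3)
    (hF : aeval p (pderiv j F) ≠ 0) (h : VanAt (m + 1) p (F * Q)) : VanAt m p Q := by
  rw [vanAt_iff, lowZero_iff] at h ⊢
  rw [map_mul, MvPolynomial.coe_mul, MvPowerSeries.order_mul] at h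
  have h1 : (shiftTo p F : MvPowerSeries (Fin 3) ℂ).order ≤ 1 := by
    have hc : MvPowerSeries.coeff (Finsupp.single j 1)
        (shiftTo p F : MvPowerSeries (Fin 3) ℂ) ≠ 0 := by
      rw [← coeff_zero_shiftTo, ← pderiv_shiftTo, coeff_pderiv] at hF
      simpa using hF
    simpa using MvPowerSeries.order_le hc
  have h2 := h.trans (add_le_add_left h1 _)
  rw [Nat.cast_add, Nat.cast_one, add_comm (1 : ℕ∞)] at h2
  exact (ENat.add_le_add_iff_right (by simp)).mp h2

/-- Restriction of a form to the standard conic. -/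
def restr : MvPolynomial (Fin 3) ℂ →ₐ[ℂ] Polynomial ℂ :=
  aeval (fun j : Fin 3 => (Polynomial.X : Polynomial ℂ) ^ (j : ℕ))

lemma eval_restr (t : ℂ) (P : MvPolynomial (Fin 3) ℂ) :
    (restr P).eval t = aeval (rncPoint 2 t) P := by
  have : (Polynomial.aeval t).comp restr = (aeval (rncPoint 2 t) : _ →ₐ[ℂ] ℂ) := by
    ext j; simp [restr, rncPoint]
  rw [← this]; simp [Polynomial.aeval_def, Polynomial.eval₂_eq_eval_map]

lemma derivative_restr (P : MvPolynomial (Fin 3) ℂ) :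
    Polynomial.derivative (restr P)
      = restr (pderiv 1 P) + 2 * Polynomial.X * restr (pderiv 2 P) := by
  induction P using MvPolynomial.induction_on with
  | C a => simp [restr]
  | add f g hf hg => simp only [map_add, hf, hg]; ring
  | mul_X f i hf =>
    have hX : restr (X i) = Polynomial.X ^ (i : ℕ) := by simp [restr]
    simp only [map_mul, Polynomial.derivative_mul, pderiv_mul, hf, hX, map_add]
    fin_cases i <;> simp [pderiv_X, Pi.single_apply] <;> ring

lemma dvd_restr (m : ℕ) (t : ℂ) (P : MvPolynomial (Fin 3) ℂ)
    (h : VanAt m (rncPoint 2 t) P) :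
    (Polynomial.X - Polynomial.C t) ^ m ∣ restr P := by
  induction m generalizing P with
  | zero => simp
  | succ m ih =>
    rw [vanAt_succ] at h
    by_cases h0 : restr P = 0
    · rw [h0]; exact dvd_zero _
    have hroot : (restr P).IsRoot t := by
      rw [Polynomial.IsRoot, eval_restr]; exact h.1
    have hd : (Polynomial.X - Polynomial.C t) ^ m ∣ Polynomial.derivative (restr P) := by
      rw [derivative_restr]
      exact dvd_add (ih _ (h.2 1)) (Dvd.dvd.mul_left (ih _ (h.2 2)) _)
    have hpos : 0 < (restr P).rootMultiplicity t :=
      (Polynomial.rootMultiplicity_pos h0).mpr hroot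
    have hdne : Polynomial.derivative (restr P) ≠ 0 := by
      intro hz
      have := Polynomial.natDegree_eq_zero_of_derivative_eq_zero hz
      rw [Polynomial.eq_C_of_natDegree_eq_zero this] at hroot h0
      simp at hroot h0
      exact h0 hroot
    have h3 := (Polynomial.le_rootMultiplicity_iff hdne).mpr hd
    rw [Polynomial.derivative_rootMultiplicity_of_root hroot] at h3
    exact (Polynomial.le_rootMultiplicity_iff h0).mp (by omega)

/-- The conic. -/
def conicF : MvPolynomial (Fin 3) ℂ := X 0 * X 2 - X 1 ^ 2

/-- Normal-form monomials of degree `d` modulo the conic. -/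
def nfMon (d w : ℕ) : MvPolynomial (Fin 3) ℂ :=
  if w ≤ d then X 0 ^ (d - w) * X 1 ^ w else X 1 ^ (2 * d - w) * X 2 ^ (w - d)

lemma mk_monomial (d : ℕ) (a b c : ℕ) (h : a + b + c = d) :
    Ideal.Quotient.mk (Ideal.span {conicF}) (X 0 ^ a * X 1 ^ b * X 2 ^ c)
      = Ideal.Quotient.mk (Ideal.span {conicF}) (nfMon d (b + 2 * c)) := by
  have key : Ideal.Quotient.mk (Ideal.span {conicF}) (X 0)
      * Ideal.Quotient.mk (Ideal.span {conicF}) (X 2)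
      = Ideal.Quotient.mk (Ideal.span {conicF}) (X 1) ^ 2 := by
    rw [← map_mul, ← map_pow, Ideal.Quotient.eq]
    exact Ideal.subset_span rfl
  unfold nfMon
  split_ifs with hw
  · obtain ⟨a', rfl⟩ : ∃ a', a = a' + c := ⟨a - c, by omega⟩
    rw [show d - (b + 2 * c) = a' by omega]
    simp only [map_mul, map_pow]
    rw [pow_add, pow_add _ b, pow_mul, ← key, mul_pow]; ring
  · obtain ⟨c', rfl⟩ : ∃ c', c = c' + a := ⟨c - a, by omega⟩
    rw [show 2 * d - (b + 2 * (c' + a)) = b + 2 * a by omega,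
      show b + 2 * (c' + a) - d = c' by omega]
    simp only [map_mul, map_pow]
    rw [pow_add _ c', pow_add _ b, pow_mul, ← key, mul_pow]; ring

/-- Linear map sending `u ^ w` to its normal form. -/
def nfMap (d : ℕ) : Polynomial ℂ →ₗ[ℂ] MvPolynomial (Fin 3) ℂ :=
  (Polynomial.basisMonomials ℂ).constr ℂ (nfMon d)

lemma nfMap_monomial (d w : ℕ) (c : ℂ) :
    nfMap d (Polynomial.monomial w c) = c • nfMon d w := by
  have h1 : nfMap d (Polynomial.monomial w 1) = nfMon d w := by
    have := (Polynomial.basisMonomials ℂ).constr_basis ℂ (nfMon d) w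
    rwa [Polynomial.coe_basisMonomials] at this
  rw [← h1, ← map_smul, Polynomial.smul_monomial, smul_eq_mul, mul_one]

lemma restr_monomial (e : Fin 3 →₀ ℕ) (c : ℂ) :
    restr (monomial e c) = Polynomial.monomial (e 1 + 2 * e 2) c := by
  rw [restr, aeval_monomial, Finsupp.prod_fintype _ _ (by simp), Fin.prod_univ_three,
    ← Polynomial.C_mul_X_pow_eq_monomial]
  simp [pow_add, pow_mul]

lemma monomial_three (e : Fin 3 →₀ ℕ) (c : ℂ) :
    monomial e c = c • (X 0 ^ e 0 * X 1 ^ e 1 * X 2 ^ e 2 : MvPolynomial (Fin 3) ℂ) := by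
  rw [monomial_eq, Finsupp.prod_fintype _ _ (by simp), Fin.prod_univ_three, smul_eq_C_mul]

lemma deg_three {d : ℕ} {P : MvPolynomial (Fin 3) ℂ} (hP : P.IsHomogeneous d)
    {e : Fin 3 →₀ ℕ} (he : e ∈ P.support) : e 0 + e 1 + e 2 = d := by
  have h2 : e.degree = d := by
    have h := hP (mem_support_iff.mp he)
    rw [Finsupp.degree_eq_weight_one]; exact h
  rw [Finsupp.degree_eq_sum, Fin.sum_univ_three] at h2
  exact h2

lemma sub_nfMap_mem {d : ℕ} {P : MvPolynomial (Fin 3) ℂ} (hP : P.IsHomogeneous d) :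
    P - nfMap d (restr P) ∈ Ideal.span {conicF} := by
  have hsum : P - nfMap d (restr P) = ∑ e ∈ P.support,
      (monomial e (coeff e P) - nfMap d (restr (monomial e (coeff e P)))) := by
    rw [Finset.sum_sub_distrib, ← map_sum, ← map_sum, ← P.as_sum]
  rw [hsum]
  refine Ideal.sum_mem _ fun e he => ?_
  rw [restr_monomial, nfMap_monomial, monomial_three, ← smul_sub, smul_eq_C_mul]
  refine Ideal.mul_mem_left _ _ ?_
  rw [← Ideal.Quotient.eq]
  exact mk_monomial d _ _ _ (deg_three hP he)

lemma natDegree_restr {d : ℕ} {P : MvPolynomial (Fin 3) ℂ} (hP : P.IsHomogeneous d) :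
    (restr P).natDegree ≤ 2 * d := by
  rw [P.as_sum, map_sum]
  refine Polynomial.natDegree_sum_le_of_forall_le _ _ fun e he => ?_
  rw [restr_monomial]
  have := deg_three hP he
  exact (Polynomial.natDegree_monomial_le _).trans (by omega)

lemma conicF_hom : conicF.IsHomogeneous 2 := by
  refine IsHomogeneous.sub ?_ ?_
  · exact (isHomogeneous_X ℂ 0).mul (isHomogeneous_X ℂ 2)
  · simpa using (isHomogeneous_X ℂ (1 : Fin 3)).pow 2

lemma step (d s : ℕ) (m : Fin s → ℕ) (tp : Fin s → ℂ) (htp : Function.Injective tp)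
    (P : MvPolynomial (Fin 3) ℂ) (hP0 : P ≠ 0) (hP : P.IsHomogeneous d)
    (hV : ∀ i, VanAt (m i + 1) (rncPoint 2 (tp i)) P) (hlt : 2 * d < ∑ i, (m i + 1)) :
    ∃ d' Q, d = d' + 2 ∧ Q ≠ 0 ∧ Q.IsHomogeneous d' ∧
      ∀ i, VanAt (m i) (rncPoint 2 (tp i)) Q := by
  have hr : restr P = 0 := by
    have hdvd : ∏ i, (Polynomial.X - Polynomial.C (tp i)) ^ (m i + 1) ∣ restr P := by
      refine Fintype.prod_dvd_of_coprime ?_ fun i => dvd_restr _ _ _ (hV i)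
      intro i j hij
      exact (Polynomial.isCoprime_X_sub_C_of_isUnit_sub
        (sub_ne_zero.mpr (htp.ne hij)).isUnit).pow
    by_contra h0
    have h1 := Polynomial.natDegree_le_of_dvd hdvd h0
    rw [Polynomial.natDegree_prod _ _ (fun i _ => pow_ne_zero _ (Polynomial.X_sub_C_ne_zero _))]
      at h1
    simp only [Polynomial.natDegree_pow, Polynomial.natDegree_X_sub_C, mul_one] at h1
    have := natDegree_restr hP
    omega
  have hmem := sub_nfMap_mem hP
  rw [hr, map_zero, sub_zero, Ideal.mem_span_singleton] at hmem
  obtain ⟨Q, hQ⟩ := hmem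
  have hsum : P = ∑ i ∈ Finset.range (Q.totalDegree + 1),
      conicF * homogeneousComponent i Q := by
    rw [← Finset.mul_sum, sum_homogeneousComponent, hQ]
  have hcomp : ∃ i, i + 2 = d ∧ P = conicF * homogeneousComponent i Q := by
    have h1 := congrArg (homogeneousComponent d) hsum
    rw [homogeneousComponent_of_mem ((mem_homogeneousSubmodule _ _).mpr hP), if_pos rfl,
      map_sum] at h1
    have h2 : ∀ i, homogeneousComponent d (conicF * homogeneousComponent i Q)
        = if i + 2 = d then conicF * homogeneousComponent i Q else 0 := by
      intro i
      rw [homogeneousComponent_of_mem (n := i + 2)]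
      · simp [eq_comm]
      · rw [mem_homogeneousSubmodule, add_comm]
        exact conicF_hom.mul (homogeneousComponent_isHomogeneous i Q)
    simp only [h2] at h1
    have h3 : ∃ i ∈ Finset.range (Q.totalDegree + 1), i + 2 = d := by
      by_contra! hc
      rw [Finset.sum_eq_zero fun i hi => if_neg (hc i hi)] at h1
      exact hP0 h1
    obtain ⟨i, hi, hid⟩ := h3
    refine ⟨i, hid, ?_⟩
    rw [Finset.sum_eq_single i, if_pos hid] at h1
    · exact h1
    · intro j _ hj
      rw [if_neg (by omega)]
    · intro h; exact absurd hi h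
  obtain ⟨i, hid, hPQ⟩ := hcomp
  refine ⟨i, homogeneousComponent i Q, hid.symm, ?_, homogeneousComponent_isHomogeneous i Q, ?_⟩
  · intro h; rw [h, mul_zero] at hPQ; exact hP0 hPQ
  · intro l
    refine vanAt_of_mul (m l) _ conicF _ 2 ?_ (hPQ ▸ hV l)
    simp [conicF, rncPoint, pderiv_mul, pderiv_pow, pderiv_X, Pi.single_apply]

lemma steps (r s : ℕ) (hs : s = r + 4) (tp : Fin s → ℂ) (htp : Function.Injective tp) (k : ℕ) :
    ∀ (d : ℕ) (m : Fin s → ℕ) (P : MvPolynomial (Fin 3) ℂ), P ≠ 0 → P.IsHomogeneous d →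
    (∀ i, VanAt (m i) (rncPoint 2 (tp i)) P) → (∀ i, k ≤ m i) →
    (2 * d + k * r < ∑ i, m i + r) →
    ∃ d' Q, d = d' + 2 * k ∧ Q ≠ 0 ∧ Q.IsHomogeneous d' ∧
      ∀ i, VanAt (m i - k) (rncPoint 2 (tp i)) Q := by
  induction k with
  | zero => intro d m P h0 hP hV _ _; exact ⟨d, P, by simp, h0, hP, by simpa using hV⟩
  | succ k ih =>
    intro d m P h0 hP hV hk hlt
    obtain ⟨m', rfl⟩ : ∃ m' : Fin s → ℕ, m = fun i => m' i + 1 :=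
      ⟨fun i => m i - 1, by ext i; have := hk i; simp only; omega⟩
    have hk' : ∀ i, k ≤ m' i := fun i => Nat.le_of_succ_le_succ (hk i)
    simp only [add_mul, one_mul] at hlt
    obtain ⟨d', Q, rfl, hQ0, hQ, hQV⟩ := step d s m' tp htp P h0 hP hV
      (by omega)
    obtain ⟨d'', Q', rfl, hQ'⟩ := ih d' m' Q hQ0 hQ hQV hk' (by
      rw [Finset.sum_add_distrib] at hlt
      simp at hlt
      omega)
    exact ⟨d'', Q', by ring, by simpa using hQ'⟩

lemma mem_linSysZ (d s : ℕ) (m : Fin s → ℕ) (tp : Fin s → ℂ) (P : MvPolynomial (Fin 3) ℂ) :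
    P ∈ linSysZ 2 (d : ℤ) s (fun i => (m i : ℤ)) tp ↔
      P.IsHomogeneous d ∧ ∀ i, VanAt (m i) (rncPoint 2 (tp i)) P := by
  rw [linSysZ, if_pos (by positivity)]
  simp [VanAt, Submodule.mem_iInf]

lemma Cb_two (a : ℤ) (h : 0 ≤ a) : 2 * Cb a 2 = a * (a - 1) := by
  obtain ⟨n, rfl⟩ := Int.eq_ofNat_of_zero_le h
  unfold Cb
  split_ifs with h2
  · have h3 : 2 ≤ n := by omega
    have h4 : n.choose 2 * 2 = n * (n - 1) := by
      rw [Nat.choose_two_right, Nat.div_mul_cancel]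
      exact (Nat.even_mul_pred_self n).two_dvd
    have h5 : ((n.choose 2 * 2 : ℕ) : ℤ) = ((n * (n - 1) : ℕ) : ℤ) := by rw [h4]
    push_cast [Nat.cast_sub (show 1 ≤ n by omega)] at h5
    change 2 * ((n.choose 2 : ℕ) : ℤ) = _
    linarith
  · have : n = 0 ∨ n = 1 := by omega
    rcases this with rfl | rfl <;> simp

lemma Cb_one (a : ℤ) (h : 0 ≤ a) : Cb a 1 = a := by
  unfold Cb
  split_ifs with h2
  · simp [h]
  · omega

lemma kC2_spec (d : ℤ) (s : ℕ) (hs : 5 ≤ s) (m : Fin s → ℤ) :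
    (∑ i, m i) - 2 * d ≤ ((s : ℤ) - 4) * kC2 d s m ∧
      ((s : ℤ) - 4) * (kC2 d s m - 1) < (∑ i, m i) - 2 * d := by
  have hpos : (0 : ℚ) < (s : ℚ) - 4 := by
    have : (5 : ℚ) ≤ s := by exact_mod_cast hs
    linarith
  have h1 := Int.le_ceil (((∑ i, (m i : ℚ)) - 2 * (d : ℚ)) / ((s : ℚ) - 4))
  have h2 := Int.ceil_lt_add_one (((∑ i, (m i : ℚ)) - 2 * (d : ℚ)) / ((s : ℚ) - 4))
  rw [← sub_lt_iff_lt_add] at h2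
  change _ ≤ ((kC2 d s m : ℤ) : ℚ) at h1
  change ((kC2 d s m : ℤ) : ℚ) - 1 < _ at h2
  rw [div_le_iff₀ hpos] at h1
  rw [lt_div_iff₀ hpos] at h2
  constructor
  · have : (((∑ i, m i) - 2 * d : ℤ) : ℚ) ≤ ((((s : ℤ) - 4) * kC2 d s m : ℤ) : ℚ) := by
      push_cast; linarith
    exact_mod_cast this
  · have : ((((s : ℤ) - 4) * (kC2 d s m - 1) : ℤ) : ℚ) < (((∑ i, m i) - 2 * d : ℤ) : ℚ) := by
      push_cast; linarith
    exact_mod_cast this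

lemma kC2_sub (d : ℤ) (s : ℕ) (hs : 5 ≤ s) (m : Fin s → ℤ) (k : ℤ) :
    kC2 (d - 2 * k) s (fun i => m i - k) = kC2 d s m - k := by
  have hne : (s : ℚ) - 4 ≠ 0 := by
    have : (5 : ℚ) ≤ s := by exact_mod_cast hs
    intro h; linarith
  unfold kC2
  rw [← Int.ceil_sub_intCast]
  congr 1
  push_cast
  rw [Finset.sum_sub_distrib]
  simp only [Finset.sum_const, Finset.card_univ, Fintype.card_fin, nsmul_eq_mul]
  field_simp
  ring

end Helpers

/-- **Removing the conic from the base locus (Lemma 1.11).** Subtracting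
`k = max(k_C, 0)` copies of the conic from an effective, non-redundant planar system
yields an effective system with nonnegative multiplicities, preserves all `k_{ij}`,
makes `k_C` nonpositive, and preserves `G`. -/
theorem stmt_10 (d s : ℕ) (hs : 5 ≤ s)
    (m : Fin s → ℕ) (tp : Fin s → ℂ) (htp : Function.Injective tp)
    (heff : linSysZ 2 (d : ℤ) s (fun i => (m i : ℤ)) tp ≠ ⊥)
    (hred : ∀ i : Fin s, kC2 (d : ℤ) s (fun i => (m i : ℤ)) ≤ (m i : ℤ)) :
    let k : ℤ := max (kC2 (d : ℤ) s (fun i => (m i : ℤ))) 0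
    let d' : ℤ := (d : ℤ) - 2 * k
    let m' : Fin s → ℤ := fun i => (m i : ℤ) - k
    (linSysZ 2 d' s m' tp ≠ ⊥) ∧
    (∀ i, 0 ≤ m' i) ∧
    (∀ i j : Fin s, i < j → m' i + m' j - d' = (m i : ℤ) + (m j : ℤ) - d) ∧
    (kC2 d' s m' ≤ 0) ∧
    (G2 d' s m' = G2 (d : ℤ) s (fun i => (m i : ℤ))) := by
  intro k d' m'
  set K : ℤ := kC2 (d : ℤ) s (fun i => (m i : ℤ)) with hK
  have hk0 : 0 ≤ k := le_max_right _ _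
  have hm' : ∀ i, 0 ≤ m' i := fun i => sub_nonneg.mpr (max_le (hred i) (by positivity))
  have hkC : kC2 d' s m' = K - k := kC2_sub d s hs (fun i => (m i : ℤ)) k
  obtain ⟨P, hPmem, hP0⟩ := Submodule.exists_mem_ne_zero_of_ne_bot heff
  have hPm := (mem_linSysZ d s m tp P).mp hPmem
  rcases le_or_gt K 0 with hneg | hpos
  · have hk : k = 0 := max_eq_right hneg
    have hd : d' = d := by simp [d', hk]
    have hm : m' = fun i => (m i : ℤ) := by ext i; simp [m', hk]
    refine ⟨by rwa [hd, hm], hm', fun i j _ => by simp only [m', d']; ring, by omega, ?_⟩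
    rw [hd, hm]
  · have hk : k = K := max_eq_left hpos.le
    obtain ⟨kn, hkn⟩ := Int.eq_ofNat_of_zero_le hk0
    obtain ⟨r, rfl⟩ : ∃ r, s = r + 4 := ⟨s - 4, by omega⟩
    have hspec := (kC2_spec d (r + 4) hs (fun i => (m i : ℤ))).2
    rw [← hK, ← hk, hkn] at hspec
    obtain ⟨e, Q, hde, hQ0, hQ, hQV⟩ := steps r (r + 4) rfl tp htp kn d m P hP0 hPm.1 hPm.2
      (fun i => by have := hm' i; simp only [m'] at this; omega)
      (by zify; push_cast at hspec; linarith)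
    have hd' : d' = (e : ℤ) := by simp only [d', hkn, hde]; push_cast; ring
    have hme : m' = fun i => ((m i - kn : ℕ) : ℤ) := by
      ext i; have := hm' i; simp only [m'] at this ⊢; omega
    refine ⟨?_, hm', fun i j _ => by simp only [m', d']; ring, by omega, ?_⟩
    · rw [hd', hme]
      intro hbot
      have := (mem_linSysZ e (r + 4) (fun i => m i - kn) tp Q).mpr ⟨hQ, hQV⟩
      rw [hbot] at this
      exact hQ0 ((Submodule.mem_bot ℂ).mp this)
    · have hpair : ∀ p : Fin (r + 4) × Fin (r + 4),
          m' p.1 + m' p.2 - d' = (m p.1 : ℤ) + (m p.2 : ℤ) - d := fun p => by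
        simp only [m', d']; ring
      unfold G2 eps2
      rw [hkC, ← hK, ← hk]
      simp only [hpair, sub_self]
      have e1 : Cb 0 2 = 0 := by simp [Cb]
      have e2 : Cb (0 + 1) 2 = 0 := by simp [Cb]
      have e3 : Cb 0 1 = 0 := by simp [Cb]
      rw [e1, e2, e3, Cb_one k hk0]
      have a1 := Cb_two ((d : ℤ) + 2) (by positivity)
      have a2 := Cb_two (d' + 2) (by rw [hd']; positivity)
      have a3 := Cb_two k hk0
      have a4 := Cb_two (k + 1) (by omega)
      have a5 : 2 * ∑ i, Cb (m' i + 1) 2 = 2 * ∑ i, Cb ((m i : ℤ) + 1) 2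
          - 2 * k * ∑ i, (m i : ℤ) - ((r + 4 : ℕ) : ℤ) * (k - k ^ 2) := by
        have : ∀ i, 2 * Cb (m' i + 1) 2
            = 2 * Cb ((m i : ℤ) + 1) 2 - 2 * k * (m i : ℤ) - (k - k ^ 2) := fun i => by
          rw [Cb_two _ (by have := hm' i; omega), Cb_two _ (by positivity)]
          simp only [m']; ring
        rw [Finset.mul_sum, Finset.sum_congr rfl fun i _ => this i, Finset.sum_sub_distrib,
          Finset.sum_sub_distrib, ← Finset.mul_sum, ← Finset.mul_sum]
        simp
        ring
      have hdd : d' = d - 2 * k := rfl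
      rw [hdd] at a2 ⊢
      push_cast at a5 ⊢
      refine mul_left_cancel₀ (two_ne_zero (α := ℤ)) ?_
      linear_combination a2 - a1 - a5 - a3 - ((r : ℤ) + 4 - 5) * a4

end
end
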